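/- Let R be a regular incline. Then for all x, y in R, the product x*y is the greatest lower bound of x and y with respect to the incline order, and x*y = y*x. -/

import Mathlib

/-- An incline: a nonempty set with `+` and `*` such that `(R,+)` is a commutative
semigroup, `(R,*)` is a semigroup, `*` distributes over `+` from both sides,
addition is idempotent, and `x + x*y = x`, `x + y*x = x` for all `x y`.
(Nonemptiness is assumed via `Nonempty R` where needed.) -/
class Incline (R : Type*) extends Add R, Mul R where
  add_comm : ∀ x y : R, x + y = y + x
  add_assoc : ∀ x y z : R, x + y + z = x + (y + z)
  mul_assoc : ∀ x y z : R, x * y * z = x * (y * z)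
  left_distrib : ∀ x y z : R, x * (y + z) = x * y + x * z
  right_distrib : ∀ x y z : R, (x + y) * z = x * z + y * z
  add_idem : ∀ x : R, x + x = x
  add_absorb_mul_left : ∀ x y : R, x + x * y = x
  add_absorb_mul_right : ∀ x y : R, x + y * x = x

/-- An element `a` of an incline is regular if `a * z * a = a` for some `z`. -/
def Incline.IsRegular {R : Type*} [Incline R] (a : R) : Prop :=
  ∃ z : R, a * z * a = a

namespace Incline

variable {R : Type*} [Incline R]

theorem mul_add_left_eq (x y : R) : x * y + x = x := by
  rw [Incline.add_comm, add_absorb_mul_left]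

theorem mul_add_right_eq (x y : R) : x * y + y = y := by
  rw [Incline.add_comm, add_absorb_mul_right]

/-- Multiplication is monotone for the incline order. -/
theorem mul_add_mul_eq {a b c d : R} (hab : a + b = b) (hcd : c + d = d) :
    a * c + b * d = b * d := by
  have hac : a * c + b * c = b * c := by rw [← Incline.right_distrib, hab]
  have hbd : b * c + b * d = b * d := by rw [← Incline.left_distrib, hcd]
  rw [← hbd, ← Incline.add_assoc, hac]

theorem IsRegular.mul_self {a : R} (ha : IsRegular a) : a * a = a := by
  obtain ⟨z, hz⟩ := ha
  have h := mul_add_mul_eq (mul_add_left_eq a z) (add_idem a)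
  rw [hz, add_absorb_mul_left] at h
  exact h.symm

theorem IsRegular.add_mul_eq {x y z : R} (hz : IsRegular z) (hx : z + x = x)
    (hy : z + y = y) : z + x * y = x * y := by
  have h := mul_add_mul_eq hx hy
  rwa [hz.mul_self] at h

end Incline

theorem regular_incline_mul_is_glb {R : Type*} [Incline R] [Nonempty R]
    (hreg : ∀ a : R, Incline.IsRegular a) :
    ∀ x y : R,
      (x * y + x = x) ∧ (x * y + y = y) ∧
        (∀ z : R, z + x = x → z + y = y → z + x * y = x * y) ∧
        x * y = y * x := by
  intro x y
  have hle (a b : R) : a * b + b * a = b * a :=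
    (hreg (a * b)).add_mul_eq (Incline.mul_add_right_eq a b) (Incline.mul_add_left_eq a b)
  refine ⟨Incline.mul_add_left_eq x y, Incline.mul_add_right_eq x y,
    fun z hx hy => (hreg z).add_mul_eq hx hy, ?_⟩
  rw [← hle y x, Incline.add_comm, hle x y]
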